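/- Let C be a left-cancellative category and S a subfamily of its morphisms. The following are equivalent: (0) S is a Garside family in C; (1) S♯ generates C, S♯ is closed under right-divisor, and every non-invertible morphism of C admits an S-head; (2) S♯ generates C, S♯ is closed under right-complement, and every non-invertible morphism that is a composite of two elements of S♯ admits an S-head; (3) S♯ generates C, S♯ is closed under right-comultiple and right-divisor, and every non-invertible morphism g that is a composite of two elements of S♯ admits a ⊏-maximal left-divisor lying in S, i.e. some g₁ ∈ S with g₁ ⊑ g such that no h ∈ S satisfies g₁ ⊏ h and h ⊑ g. -/

import Mathlib

open CategoryTheory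

universe u v

namespace GarsideTest

variable {C : Type u} [Category.{v} C]

/-- `C` is left-cancellative. -/
def LeftCancellative (C : Type u) [Category.{v} C] : Prop :=
  ∀ ⦃x y z : C⦄ (f : x ⟶ y) (g g' : y ⟶ z), f ≫ g = f ≫ g' → g = g'

/-- `f` left-divides `g`. -/
def LDiv {x y z : C} (f : x ⟶ y) (g : x ⟶ z) : Prop :=
  ∃ r : y ⟶ z, f ≫ r = g

/-- `f` properly left-divides `g` (`f ⊏ g`). -/
def LDivStrict {x y z : C} (f : x ⟶ y) (g : x ⟶ z) : Prop :=
  LDiv f g ∧ ¬ LDiv g f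

/-- `f =× g` : `g` is obtained from `f` by right-multiplication by an invertible element. -/
def EqIr {x y z : C} (f : x ⟶ y) (g : x ⟶ z) : Prop :=
  ∃ e : y ⟶ z, IsIso e ∧ f ≫ e = g

/-- The family `S♯ = S C× ∪ C×`. -/
def Sharp (S : MorphismProperty C) : MorphismProperty C :=
  fun x z g =>
    (∃ (y : C) (s : x ⟶ y) (e : y ⟶ z), S s ∧ IsIso e ∧ s ≫ e = g) ∨ IsIso g

/-- Composable paths of morphisms of `C`. -/
inductive Path {C : Type u} [Category.{v} C] : C → C → Type (max u v)
  | nil (x : C) : Path x x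
  | cons {x y z : C} (g : x ⟶ y) (p : Path y z) : Path x z

namespace Path

/-- The composite of a path. -/
def comp : ∀ {x z : C}, Path x z → (x ⟶ z)
  | _, _, nil x => 𝟙 x
  | _, _, cons g p => g ≫ p.comp

/-- The length of a path. -/
def length : ∀ {x z : C}, Path x z → ℕ
  | _, _, nil _ => 0
  | _, _, cons _ p => p.length + 1

/-- All entries of the path lie in `T`. -/
def Entries (T : MorphismProperty C) : ∀ {x z : C}, Path x z → Prop
  | _, _, nil _ => True
  | _, _, cons g p => T g ∧ Entries T p

/-- Concatenation of paths. -/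
def append : ∀ {x y z : C}, Path x y → Path y z → Path x z
  | _, _, _, nil _, q => q
  | _, _, _, cons g p, q => cons g (p.append q)

open scoped Classical in
/-- Number of non-invertible entries of a path. -/
noncomputable def ninv : ∀ {x z : C}, Path x z → ℕ
  | _, _, nil _ => 0
  | _, _, cons g p => (if IsIso g then 0 else 1) + p.ninv

end Path

/-- The length-two path `(g₁, g₂)` is `S`-greedy. -/
def Greedy2 (S : MorphismProperty C) {x y z : C} (g₁ : x ⟶ y) (g₂ : y ⟶ z) : Prop :=
  ∀ ⦃u w : C⦄ (f : u ⟶ x) (h : u ⟶ w), S h → LDiv h (f ≫ g₁ ≫ g₂) → LDiv h (f ≫ g₁)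

/-- Auxiliary: the path `g :: p` is `S`-greedy. -/
def Path.GreedyFrom (S : MorphismProperty C) : ∀ {x y z : C}, (x ⟶ y) → Path y z → Prop
  | _, _, _, _, .nil _ => True
  | _, _, _, g, .cons g' p => Greedy2 S g g' ∧ Path.GreedyFrom S g' p

/-- The path `p` is `S`-greedy. -/
def Path.Greedy (S : MorphismProperty C) : ∀ {x z : C}, Path x z → Prop
  | _, _, .nil _ => True
  | _, _, .cons g p => Path.GreedyFrom S g p

/-- The path `p` is `S`-normal: `S`-greedy with entries in `S♯`. -/
def Path.Normal (S : MorphismProperty C) {x z : C} (p : Path x z) : Prop :=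
  p.Greedy S ∧ p.Entries (Sharp S)

/-- `p` is an `S`-normal decomposition of the morphism `g`. -/
def IsNormalDecomp (S : MorphismProperty C) {x z : C} (g : x ⟶ z) (p : Path x z) : Prop :=
  p.Normal S ∧ p.comp = g

/-- `X` generates `C`. -/
def Generates (X : MorphismProperty C) : Prop :=
  ∀ ⦃x z : C⦄ (g : x ⟶ z), ∃ p : Path x z, p.Entries X ∧ p.comp = g

/-- `S` is a Garside family in `C`. -/
def IsGarside (S : MorphismProperty C) : Prop :=
  ∀ ⦃x z : C⦄ (g : x ⟶ z), ∃ p : Path x z, IsNormalDecomp S g p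

/-- `Xʳ`: morphisms expressible as composites of `r` elements of `X`. -/
def MPow (X : MorphismProperty C) (r : ℕ) : MorphismProperty C :=
  fun x z g => ∃ p : Path x z, p.Entries X ∧ p.length = r ∧ p.comp = g

/-- `X` is closed under right-complement. -/
def ClosedUnderRightComplement (X : MorphismProperty C) : Prop :=
  ∀ ⦃x y y' z : C⦄ (f : x ⟶ y) (g : x ⟶ y') (h : x ⟶ z), X f → X g →
    LDiv f h → LDiv g h →
    ∃ (w : C) (g' : y ⟶ w) (f' : y' ⟶ w),
      X g' ∧ X f' ∧ f ≫ g' = g ≫ f' ∧ LDiv (f ≫ g') h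

/-- `X` is closed under right-comultiple. -/
def ClosedUnderRightComultiple (X : MorphismProperty C) : Prop :=
  ∀ ⦃x y y' z : C⦄ (f : x ⟶ y) (g : x ⟶ y') (h : x ⟶ z), X f → X g →
    LDiv f h → LDiv g h →
    ∃ (w : C) (h' : x ⟶ w), X h' ∧ LDiv f h' ∧ LDiv g h' ∧ LDiv h' h

/-- `X` is closed under right-divisor. -/
def ClosedUnderRightDivisor (X : MorphismProperty C) : Prop :=
  ∀ ⦃x y z : C⦄ (f : x ⟶ y) (g : y ⟶ z), X (f ≫ g) → X g

/-- `g₁` is an `S`-head of `g`. -/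
def IsHead (S : MorphismProperty C) {x w y : C} (g₁ : x ⟶ w) (g : x ⟶ y) : Prop :=
  S g₁ ∧ LDiv g₁ g ∧ ∀ ⦃w' : C⦄ (h : x ⟶ w'), S h → LDiv h g → LDiv h g₁

/-- `h` is a right-lcm of `f` and `g`. -/
def IsRightLcm {x y y' w : C} (f : x ⟶ y) (g : x ⟶ y') (h : x ⟶ w) : Prop :=
  LDiv f h ∧ LDiv g h ∧ ∀ ⦃w' : C⦄ (h' : x ⟶ w'), LDiv f h' → LDiv g h' → LDiv h h'

/-- `X` is closed under right-lcm. -/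
def ClosedUnderRightLcm (X : MorphismProperty C) : Prop :=
  ∀ ⦃x y y' w : C⦄ (f : x ⟶ y) (g : x ⟶ y') (h : x ⟶ w), X f → X g →
    IsRightLcm f g h → X h

/-- `C` is right-Noetherian: proper right-divisibility is well-founded. -/
def RightNoetherian (C : Type u) [Category.{v} C] : Prop :=
  WellFounded (fun a b : Σ (x : C) (y : C), x ⟶ y =>
    ∃ (e : a.2.1 = b.2.1) (g' : b.1 ⟶ a.1), ¬ IsIso g' ∧ g' ≫ a.2.2 ≫ eqToHom e = b.2.2)

/-- `C` is left-Noetherian: proper left-divisibility is well-founded. -/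
def LeftNoetherian (C : Type u) [Category.{v} C] : Prop :=
  WellFounded (fun a b : Σ (x : C) (y : C), x ⟶ y =>
    ∃ (e : b.1 = a.1) (g' : a.2.1 ⟶ b.2.1), ¬ IsIso g' ∧ eqToHom e ≫ a.2.2 ≫ g' = b.2.2)

/-- `g` is an atom of `C`. -/
def IsAtomMor {x y : C} (g : x ⟶ y) : Prop :=
  ¬ IsIso g ∧ ∀ ⦃w : C⦄ (f : x ⟶ w) (h : w ⟶ y), f ≫ h = g → IsIso f ∨ IsIso h

/-- The only invertible morphisms of `C` are identities. -/
def NoNontrivialInvertible (C : Type u) [Category.{v} C] : Prop :=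
  ∀ ⦃x y : C⦄ (e : x ⟶ y), IsIso e → ∃ h : x = y, e = eqToHom h

/-- Deformation by invertible elements, with a connecting morphism `e` at the left end. -/
inductive DeformRel : ∀ {xf xg z : C}, (xf ⟶ xg) → Path xf z → Path xg z → Prop
  | nil (z : C) : DeformRel (𝟙 z) (.nil z) (.nil z)
  | cons {xf xg yf yg z : C} (e : xf ⟶ xg) (f : xf ⟶ yf) (g : xg ⟶ yg) (e' : yf ⟶ yg)
      {p : Path yf z} {q : Path yg z} :
      IsIso e' → e ≫ g = f ≫ e' → DeformRel e' p q →
      DeformRel e (.cons f p) (.cons g q)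
  | padF {xg yg z : C} (e : z ⟶ xg) (g : xg ⟶ yg) (e' : z ⟶ yg) {q : Path yg z} :
      IsIso e' → e ≫ g = e' → DeformRel e' (.nil z) q →
      DeformRel e (.nil z) (.cons g q)
  | padG {xf yf z : C} (e : xf ⟶ z) (f : xf ⟶ yf) (e' : yf ⟶ z) {p : Path yf z} :
      IsIso e' → e = f ≫ e' → DeformRel e' p (.nil z) →
      DeformRel e (.cons f p) (.nil z)

/-- `p` is a `C×`-deformation of `q`. -/
def IsDeformation {x z : C} (p q : Path x z) : Prop :=
  DeformRel (𝟙 x) p q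

namespace LDiv

theorem refl {x y : C} (f : x ⟶ y) : LDiv f f := ⟨𝟙 y, Category.comp_id f⟩

theorem trans {x y z w : C} {f : x ⟶ y} {g : x ⟶ z} {h : x ⟶ w} :
    LDiv f g → LDiv g h → LDiv f h := by
  rintro ⟨r, rfl⟩ ⟨r', rfl⟩
  exact ⟨r ≫ r', (Category.assoc ..).symm⟩

theorem comp_right {x y z : C} (f : x ⟶ y) (g : y ⟶ z) : LDiv f (f ≫ g) := ⟨g, rfl⟩

theorem comp_left {x y z w : C} (f : x ⟶ y) {g : y ⟶ z} {h : y ⟶ w} :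
    LDiv g h → LDiv (f ≫ g) (f ≫ h) := by
  rintro ⟨r, rfl⟩
  exact ⟨r, Category.assoc ..⟩

theorem of_isIso {x y z : C} (f : x ⟶ y) (g : x ⟶ z) (hf : IsIso f) : LDiv f g :=
  ⟨inv f ≫ g, IsIso.hom_inv_id_assoc f g⟩

theorem comp_isIso {x y z w : C} {f : x ⟶ y} {e : y ⟶ z} {g : x ⟶ w} (he : IsIso e)
    (h : LDiv f g) : LDiv (f ≫ e) g := by
  obtain ⟨r, rfl⟩ := h
  exact ⟨inv e ≫ r, by simp⟩

end LDiv

namespace LeftCancellative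

theorem ldiv_cancel (hC : LeftCancellative C) {x y z w : C} (f : x ⟶ y) {g : y ⟶ z} {h : y ⟶ w}
    (H : LDiv (f ≫ g) (f ≫ h)) : LDiv g h := by
  obtain ⟨r, hr⟩ := H
  exact ⟨r, hC f _ _ (by rw [← hr, Category.assoc])⟩

theorem isIso_of_comp_eq_id (hC : LeftCancellative C)
    {x y : C} {f : x ⟶ y} {r : y ⟶ x} (h : f ≫ r = 𝟙 x) : IsIso f :=
  ⟨r, h, hC f _ _ (by rw [← Category.assoc, h, Category.id_comp, Category.comp_id])⟩

theorem isIso_of_ldiv (hC : LeftCancellative C)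
    {x y z : C} {f : x ⟶ y} {g : x ⟶ z} (hg : IsIso g)
    (h : LDiv f g) : IsIso f := by
  obtain ⟨r, rfl⟩ := h
  exact hC.isIso_of_comp_eq_id (r := r ≫ inv (f ≫ r))
    (by rw [← Category.assoc, IsIso.hom_inv_id])

theorem eqIr_of_ldiv (hC : LeftCancellative C)
    {x y z : C} {f : x ⟶ y} {g : x ⟶ z} (hfg : LDiv f g)
    (hgf : LDiv g f) : EqIr f g := by
  obtain ⟨r, rfl⟩ := hfg
  obtain ⟨r', hr'⟩ := hgf
  exact ⟨r, hC.isIso_of_comp_eq_id (r := r')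
    (hC f _ _ (by rw [← Category.assoc, hr', Category.comp_id])), rfl⟩

end LeftCancellative

namespace Sharp

variable {S : MorphismProperty C}

theorem of_mem {x y : C} {s : x ⟶ y} (hs : S s) : Sharp S s :=
  Or.inl ⟨y, s, 𝟙 y, hs, inferInstance, Category.comp_id s⟩

theorem of_isIso {x y : C} {e : x ⟶ y} (he : IsIso e) : Sharp S e := Or.inr he

theorem id (x : C) : Sharp S (𝟙 x) := of_isIso inferInstance

theorem comp_isIso {x y z : C} {t : x ⟶ y} {e : y ⟶ z} (ht : Sharp S t) (he : IsIso e) :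
    Sharp S (t ≫ e) := by
  rcases ht with ⟨w, s, e', hs, he', rfl⟩ | ht
  · exact Or.inl ⟨w, s, e' ≫ e, hs, inferInstance, (Category.assoc ..).symm⟩
  · exact Or.inr inferInstance

theorem of_eqIr {x y z : C} {f : x ⟶ y} {g : x ⟶ z} (hf : Sharp S f) (h : EqIr f g) :
    Sharp S g := by
  obtain ⟨e, he, rfl⟩ := h
  exact hf.comp_isIso he

/-- Left-divisibility statements for `S` extend to `S♯`. -/
theorem ldiv_of_forall {x y z w : C} {g : x ⟶ y} {g' : x ⟶ z}
    (H : ∀ ⦃w : C⦄ (h : x ⟶ w), S h → LDiv h g → LDiv h g') {h : x ⟶ w}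
    (hh : Sharp S h) (hg : LDiv h g) : LDiv h g' := by
  rcases hh with ⟨w, s, e, hs, he, rfl⟩ | hh
  · exact (H s hs ((LDiv.comp_right s e).trans hg)).comp_isIso he
  · exact .of_isIso _ _ hh

end Sharp

/-- `g₁` is a left-divisor of `g` in `S♯` that absorbs, after any left-multiplication, all
left-divisors lying in `S♯`. -/
def IsGreedyHead (S : MorphismProperty C) {x y z : C} (g₁ : x ⟶ y) (g : x ⟶ z) : Prop :=
  Sharp S g₁ ∧ LDiv g₁ g ∧ ∀ ⦃u w : C⦄ (f : u ⟶ x) (h : u ⟶ w), Sharp S h →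
    LDiv h (f ≫ g) → LDiv h (f ≫ g₁)

theorem IsGreedyHead.ldiv {S : MorphismProperty C} {x y z w : C} {g₁ : x ⟶ y} {g : x ⟶ z}
    (hg : IsGreedyHead S g₁ g) {h : x ⟶ w} (hh : Sharp S h) (hd : LDiv h g) : LDiv h g₁ := by
  simpa using hg.2.2 (𝟙 x) h hh (by simpa using hd)

theorem Path.GreedyFrom.ldiv {S : MorphismProperty C} {x y z u w : C} {g : x ⟶ y}
    {p : Path y z} (hp : Path.GreedyFrom S g p) (f : u ⟶ x) {h : u ⟶ w} (hh : S h)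
    (hd : LDiv h (f ≫ g ≫ p.comp)) : LDiv h (f ≫ g) := by
  induction p generalizing x with
  | nil => simpa [Path.comp] using hd
  | cons g' p ih =>
    refine hp.1 f h hh ?_
    simpa using ih hp.2 (f ≫ g) (by simpa [Path.comp] using hd)

section Garside

variable {S : MorphismProperty C}

theorem IsGarside.exists_isGreedyHead (hS : IsGarside S) {x z : C} (g : x ⟶ z) :
    ∃ (y : C) (g₁ : x ⟶ y), IsGreedyHead S g₁ g := by
  obtain ⟨p, ⟨hp, hpe⟩, rfl⟩ := hS g
  cases p with
  | nil => exact ⟨x, 𝟙 x, .id x, .refl _, fun _ _ _ _ _ h => h⟩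
  | cons g p =>
    exact ⟨_, g, hpe.1, .comp_right _ _, fun u w f h hh hd =>
      Sharp.ldiv_of_forall (fun _ h hh hd => hp.ldiv f hh hd) hh hd⟩

theorem IsGarside.generates (hS : IsGarside S) : Generates (Sharp S) := fun _ _ g =>
  let ⟨p, hp, hg⟩ := hS g
  ⟨p, hp.2, hg⟩

theorem IsGarside.closedUnderRightDivisor (hC : LeftCancellative C) (hS : IsGarside S) :
    ClosedUnderRightDivisor (Sharp S) := by
  intro x y z f g hfg
  obtain ⟨w, g₁, hg₁⟩ := hS.exists_isGreedyHead g
  exact hg₁.1.of_eqIr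
    (hC.eqIr_of_ldiv hg₁.2.1 (hC.ldiv_cancel f (hg₁.2.2 f _ hfg (.refl _))))

theorem isIso_of_isGreedyHead (hC : LeftCancellative C) {x y z : C} {g₁ : x ⟶ y}
    {p : Path x z} (hp : p.Entries (Sharp S)) (hg₁ : IsIso g₁)
    (h : IsGreedyHead S g₁ p.comp) : IsIso p.comp := by
  induction p generalizing y with
  | nil => exact inferInstanceAs (IsIso (𝟙 _))
  | cons t p ih =>
    have ht : IsIso t := hC.isIso_of_ldiv hg₁ (h.ldiv hp.1 (.comp_right _ _))
    have : IsIso p.comp := by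
      refine ih hp.2 (g₁ := inv t ≫ g₁) inferInstance
        ⟨.of_isIso inferInstance, .of_isIso _ _ inferInstance, fun u w f k hk hd => ?_⟩
      simpa using h.2.2 (f ≫ inv t) k hk (by simpa [Path.comp] using hd)
    exact inferInstanceAs (IsIso (t ≫ p.comp))

theorem IsGarside.exists_isHead (hC : LeftCancellative C) (hS : IsGarside S) {x z : C}
    (g : x ⟶ z) (hg : ¬ IsIso g) : ∃ (w : C) (g₁ : x ⟶ w), IsHead S g₁ g := by
  obtain ⟨y, g₁, h⟩ := hS.exists_isGreedyHead g
  have hh := h.1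
  rcases hh with ⟨w, s, e, hs, he, rfl⟩ | hg₁
  · refine ⟨w, s, hs, (LDiv.comp_right _ _).trans h.2.1, fun w' k hk hd => ?_⟩
    exact (h.ldiv (.of_mem hk) hd).trans (LDiv.comp_isIso he (.refl s))
  · obtain ⟨p, hp, rfl⟩ := hS.generates g
    exact absurd (isIso_of_isGreedyHead hC hp hg₁ h) hg

theorem IsGarside.closedUnderRightComplement (hC : LeftCancellative C) (hS : IsGarside S) :
    ClosedUnderRightComplement (Sharp S) := by
  intro x y y' z f g h hf hg hfh hgh
  obtain ⟨w, h₁, hh⟩ := hS.exists_isGreedyHead h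
  obtain ⟨g', hg'⟩ := hh.ldiv hf hfh
  obtain ⟨f', hf'⟩ := hh.ldiv hg hgh
  have hdiv := hS.closedUnderRightDivisor hC
  exact ⟨w, g', f', hdiv f g' (hg' ▸ hh.1), hdiv g f' (hf' ▸ hh.1), hg'.trans hf'.symm,
    hg' ▸ hh.2.1⟩

end Garside

section Recognition

variable {S : MorphismProperty C}

theorem IsHead.ldiv {x y z w : C} {g₁ : x ⟶ y} {g : x ⟶ z} (hg : IsHead S g₁ g)
    {h : x ⟶ w} (hh : Sharp S h) (hd : LDiv h g) : LDiv h g₁ :=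
  Sharp.ldiv_of_forall hg.2.2 hh hd

theorem IsHead.not_ldivStrict {x y z w : C} {g₁ : x ⟶ y} {g : x ⟶ z} (hg : IsHead S g₁ g)
    {h : x ⟶ w} (hh : S h) (hd : LDiv h g) : ¬ LDivStrict g₁ h :=
  fun hs => hs.2 (hg.2.2 h hh hd)

theorem MPow.comp₂ {X : MorphismProperty C} {x y z : C} {f : x ⟶ y} {g : y ⟶ z} (hf : X f)
    (hg : X g) : MPow X 2 (f ≫ g) :=
  ⟨.cons f (.cons g (.nil z)), ⟨hf, hg, trivial⟩, rfl, by simp [Path.comp]⟩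

theorem closedUnderRightComultiple_of_exists_isHead
    (hS : ∀ ⦃x y : C⦄ (g : x ⟶ y), ¬ IsIso g → ∃ (w : C) (g₁ : x ⟶ w), IsHead S g₁ g) :
    ClosedUnderRightComultiple (Sharp S) := by
  intro x y y' z f g h hf hg hfh hgh
  by_cases hi : IsIso h
  · exact ⟨z, h, .of_isIso hi, hfh, hgh, .refl h⟩
  · obtain ⟨w, s, hs⟩ := hS h hi
    exact ⟨w, s, .of_mem hs.1, hs.ldiv hf hfh, hs.ldiv hg hgh, hs.2.1⟩

theorem ClosedUnderRightComplement.closedUnderRightComultiple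
    (hS : ClosedUnderRightComplement (Sharp S))
    (hhead : ∀ ⦃x y : C⦄ (g : x ⟶ y), ¬ IsIso g → MPow (Sharp S) 2 g →
      ∃ (w : C) (g₁ : x ⟶ w), IsHead S g₁ g) :
    ClosedUnderRightComultiple (Sharp S) := by
  intro x y y' z f g h hf hg hfh hgh
  obtain ⟨w, g', f', hg', hf', he, hd⟩ := hS f g h hf hg hfh hgh
  have hgd : LDiv g (f ≫ g') := ⟨f', he.symm⟩
  by_cases hi : IsIso (f ≫ g')
  · exact ⟨w, f ≫ g', .of_isIso hi, .comp_right _ _, hgd, hd⟩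
  · obtain ⟨w', s, hs⟩ := hhead _ hi (.comp₂ hf hg')
    exact ⟨w', s, .of_mem hs.1, hs.ldiv hf (.comp_right _ _), hs.ldiv hg hgd, hs.2.1.trans hd⟩

theorem ClosedUnderRightComplement.closedUnderRightDivisor (hC : LeftCancellative C)
    (hgen : Generates (Sharp S)) (hS : ClosedUnderRightComplement (Sharp S)) :
    ClosedUnderRightDivisor (Sharp S) := by
  intro x y z f g hfg
  obtain ⟨p, hp, rfl⟩ := hgen f
  induction p with
  | nil => simpa [Path.comp] using hfg
  | cons t p ih =>
    refine ih g hp.2 ?_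
    simp only [Path.comp, Category.assoc] at hfg
    obtain ⟨w, g', f', hg', hf', he, hd⟩ := hS t _ _ hp.1 hfg (.comp_right _ _) (.refl _)
    refine hg'.of_eqIr (hC.eqIr_of_ldiv (hC.ldiv_cancel t hd) (hC.ldiv_cancel t ?_))
    exact ⟨f', he.symm⟩

theorem exists_sharp_head_of_maximal (hmul : ClosedUnderRightComultiple (Sharp S))
    {x z : C} {g : x ⟶ z}
    (hg : ¬ IsIso g → ∃ (w : C) (g₁ : x ⟶ w), S g₁ ∧ LDiv g₁ g ∧
      ∀ ⦃w' : C⦄ (h : x ⟶ w'), S h → LDiv h g → ¬ LDivStrict g₁ h) :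
    ∃ (y : C) (t : x ⟶ y), Sharp S t ∧ LDiv t g ∧
      ∀ ⦃w : C⦄ (h : x ⟶ w), Sharp S h → LDiv h g → LDiv h t := by
  by_cases hi : IsIso g
  · exact ⟨z, g, .of_isIso hi, .refl g, fun _ _ _ h => h⟩
  obtain ⟨w, s, hs, hsg, hmax⟩ := hg hi
  refine ⟨w, s, .of_mem hs, hsg, fun w' h hh hd => ?_⟩
  obtain ⟨v, m, hm, hsm, hhm, hmg⟩ := hmul s h g (.of_mem hs) hh hsg hd
  refine hhm.trans ?_
  rcases hm with ⟨v', s', e, hs', he, rfl⟩ | hm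
  · refine LDiv.comp_isIso he ?_
    by_contra hn
    exact hmax s' hs' ((LDiv.comp_right _ _).trans hmg)
      ⟨hsm.trans (LDiv.comp_isIso he (.refl s')), hn⟩
  · exact .of_isIso _ _ hm

theorem isGreedyHead_of_sharp_head (hC : LeftCancellative C) (hgen : Generates (Sharp S))
    (hmul : ClosedUnderRightComultiple (Sharp S)) (hdiv : ClosedUnderRightDivisor (Sharp S))
    {x y z : C} {t : x ⟶ y} {g : x ⟶ z} (ht : Sharp S t) (htg : LDiv t g)
    (hmax : ∀ ⦃w : C⦄ (h : x ⟶ w), Sharp S h → LDiv h g → LDiv h t) :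
    IsGreedyHead S t g := by
  refine ⟨ht, htg, fun u w f h hh hd => ?_⟩
  obtain ⟨p, hp, rfl⟩ := hgen f
  induction p generalizing w with
  | nil => simpa [Path.comp] using hmax h hh (by simpa [Path.comp] using hd)
  | cons f₁ p ih =>
    simp only [Path.comp, Category.assoc] at hd ⊢
    obtain ⟨v, m, hm, hhm, ⟨m', rfl⟩, hmg⟩ :=
      hmul h f₁ _ hh hp.1 hd (.comp_right _ _)
    exact hhm.trans (.comp_left f₁
      (ih ht htg hmax v m' (hdiv f₁ m' hm) hp.2 (hC.ldiv_cancel f₁ hmg)))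

theorem exists_isGreedyHead_path (hC : LeftCancellative C)
    (hdiv : ClosedUnderRightDivisor (Sharp S))
    (hhead : ∀ ⦃x y z : C⦄ (a : x ⟶ y) (b : y ⟶ z), Sharp S a → Sharp S b →
      ∃ (w : C) (t : x ⟶ w), IsGreedyHead S t (a ≫ b))
    {x y z : C} {t : x ⟶ y} {p : Path y z} (ht : Sharp S t) (hp : p.Entries (Sharp S)) :
    ∃ (w : C) (t₁ : x ⟶ w) (q : Path w z), IsGreedyHead S t₁ (t ≫ p.comp) ∧
      q.Entries (Sharp S) ∧ q.length = p.length ∧ t₁ ≫ q.comp = t ≫ p.comp := by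
  induction p generalizing x with
  | nil y =>
    exact ⟨y, t, .nil y, by simpa [Path.comp] using ⟨ht, .refl t, fun _ _ _ _ _ h => h⟩,
      trivial, rfl, rfl⟩
  | cons g p ih =>
    obtain ⟨v, u, q, hu, hq, hl, he⟩ := ih hp.1 hp.2
    obtain ⟨w, t₁, ht₁⟩ := hhead t u ht hu.1
    obtain ⟨r, hr⟩ := ht₁.2.1
    obtain ⟨a, rfl⟩ := ht₁.ldiv ht (.comp_right t u)
    have har : a ≫ r = u := hC t _ _ (by rw [← hr, Category.assoc])
    have hcomp : (t ≫ a) ≫ r ≫ q.comp = t ≫ g ≫ p.comp := by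
      rw [← he, ← har]; simp
    refine ⟨w, t ≫ a, .cons r q, ⟨ht₁.1, ⟨_, hcomp⟩, fun _ _ f h hh hd => ?_⟩,
      ⟨hdiv a r (har ▸ hu.1), hq⟩, congrArg (· + 1) hl, hcomp⟩
    refine ht₁.2.2 f h hh ?_
    simpa using hu.2.2 (f ≫ t) h hh (by simpa [Path.comp] using hd)

theorem isGarside_of_exists_isGreedyHead (hC : LeftCancellative C)
    (hgen : Generates (Sharp S)) (hdiv : ClosedUnderRightDivisor (Sharp S))
    (hhead : ∀ ⦃x y z : C⦄ (a : x ⟶ y) (b : y ⟶ z), Sharp S a → Sharp S b →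
      ∃ (w : C) (t : x ⟶ w), IsGreedyHead S t (a ≫ b)) :
    IsGarside S := by
  suffices H : ∀ (n : ℕ) ⦃x z : C⦄ (p : Path x z), p.Entries (Sharp S) → p.length = n →
      ∃ q : Path x z, IsNormalDecomp S p.comp q by
    intro x z g
    obtain ⟨p, hp, rfl⟩ := hgen g
    exact H _ p hp rfl
  intro n
  induction n with
  | zero =>
    intro x z p hp hl
    cases p with
    | nil => exact ⟨.nil x, ⟨trivial, trivial⟩, rfl⟩
    | cons => simp [Path.length] at hl
  | succ n ih =>
    intro x z p hp hl
    cases p with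
    | nil => simp [Path.length] at hl
    | cons t p =>
      obtain ⟨w, t₁, q, ht₁, hq, hlq, he⟩ := exists_isGreedyHead_path hC hdiv hhead hp.1 hp.2
      obtain ⟨r, ⟨hr, hre⟩, hrc⟩ := ih q hq (hlq.trans (Nat.succ.inj hl))
      refine ⟨.cons t₁ r, ⟨?_, ht₁.1, hre⟩, by simpa only [Path.comp, hrc] using he⟩
      cases r with
      | nil => exact trivial
      | cons r₁ r =>
        refine ⟨fun u v f h hh hd => ht₁.2.2 f h (.of_mem hh) (hd.trans ⟨r.comp, ?_⟩), hr⟩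
        rw [← he, ← hrc]
        simp [Path.comp]

theorem isGarside_of_exists_maximal (hC : LeftCancellative C)
    (hgen : Generates (Sharp S)) (hmul : ClosedUnderRightComultiple (Sharp S))
    (hdiv : ClosedUnderRightDivisor (Sharp S))
    (hmax : ∀ ⦃x y : C⦄ (g : x ⟶ y), ¬ IsIso g → MPow (Sharp S) 2 g →
      ∃ (w : C) (g₁ : x ⟶ w), S g₁ ∧ LDiv g₁ g ∧
        ∀ ⦃w' : C⦄ (h : x ⟶ w'), S h → LDiv h g → ¬ LDivStrict g₁ h) :
    IsGarside S := by
  refine isGarside_of_exists_isGreedyHead hC hgen hdiv fun x y z a b ha hb => ?_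
  obtain ⟨w, t, ht, htg, h⟩ :=
    exists_sharp_head_of_maximal hmul fun hi => hmax (a ≫ b) hi (.comp₂ ha hb)
  exact ⟨w, t, isGreedyHead_of_sharp_head hC hgen hmul hdiv ht htg h⟩

end Recognition

theorem stmt12 {C : Type u} [Category.{v} C] (hC : LeftCancellative C)
    (S : MorphismProperty C) :
    (IsGarside S ↔
      (Generates (Sharp S) ∧ ClosedUnderRightDivisor (Sharp S) ∧
        ∀ ⦃x y : C⦄ (g : x ⟶ y), ¬ IsIso g → ∃ (w : C) (g₁ : x ⟶ w), IsHead S g₁ g)) ∧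
    (IsGarside S ↔
      (Generates (Sharp S) ∧ ClosedUnderRightComplement (Sharp S) ∧
        ∀ ⦃x y : C⦄ (g : x ⟶ y), ¬ IsIso g → MPow (Sharp S) 2 g →
          ∃ (w : C) (g₁ : x ⟶ w), IsHead S g₁ g)) ∧
    (IsGarside S ↔
      (Generates (Sharp S) ∧ ClosedUnderRightComultiple (Sharp S) ∧
        ClosedUnderRightDivisor (Sharp S) ∧
        ∀ ⦃x y : C⦄ (g : x ⟶ y), ¬ IsIso g → MPow (Sharp S) 2 g →
          ∃ (w : C) (g₁ : x ⟶ w), S g₁ ∧ LDiv g₁ g ∧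
            ∀ ⦃w' : C⦄ (h : x ⟶ w'), S h → LDiv h g → ¬ LDivStrict g₁ h)) := by
  refine ⟨⟨fun h => ⟨h.generates, h.closedUnderRightDivisor hC,
      fun _ _ => h.exists_isHead hC⟩, ?_⟩,
    ⟨fun h => ⟨h.generates, h.closedUnderRightComplement hC,
      fun _ _ g hg _ => h.exists_isHead hC g hg⟩, ?_⟩,
    ⟨fun h => ⟨h.generates,
      closedUnderRightComultiple_of_exists_isHead fun _ _ => h.exists_isHead hC,
      h.closedUnderRightDivisor hC, fun _ _ g hg _ => ?_⟩, ?_⟩⟩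
  · rintro ⟨hgen, hdiv, hhead⟩
    refine isGarside_of_exists_maximal hC hgen
      (closedUnderRightComultiple_of_exists_isHead hhead) hdiv fun _ _ g hg _ => ?_
    obtain ⟨w, s, hs⟩ := hhead g hg
    exact ⟨w, s, hs.1, hs.2.1, fun _ _ => hs.not_ldivStrict⟩
  · rintro ⟨hgen, hcompl, hhead⟩
    refine isGarside_of_exists_maximal hC hgen (hcompl.closedUnderRightComultiple hhead)
      (hcompl.closedUnderRightDivisor hC hgen) fun _ _ g hg hg₂ => ?_
    obtain ⟨w, s, hs⟩ := hhead g hg hg₂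
    exact ⟨w, s, hs.1, hs.2.1, fun _ _ => hs.not_ldivStrict⟩
  · obtain ⟨w, s, hs⟩ := h.exists_isHead hC g hg
    exact ⟨w, s, hs.1, hs.2.1, fun _ _ => hs.not_ldivStrict⟩
  · rintro ⟨hgen, hmul, hdiv, hmax⟩
    exact isGarside_of_exists_maximal hC hgen hmul hdiv hmax

end GarsideTest
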